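/- arXiv:1011.3414 — 3 statements merged into one kernel-verified Lean document; each statement's English description precedes it below -/
import Mathlib

section
/- Let T > 0 and let U : [0,T] → ℝ^d be a solution of system (1.1). Then for every t ∈ [0,T] and every k ∈ {1,…,d}, |U_k(t)| ≤ max{ max_{j=1,…,d} |U_j(0)| , max_{0 ≤ s ≤ t} |U_d(s)| }. -/
open scoped BigOperators
open Filter Topology Set

/-- The `n`-th coordinate (0-based) of a vector in `ℝ^d`, with junk value `0` out of range. -/
noncomputable def coordFn {d : ℕ} (u : Fin d → ℝ) (n : ℕ) : ℝ :=
  if hn : n < d then u ⟨n, hn⟩ else 0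

/-- The vector field `b` of system (1.1) (0-based indices: coordinate `1 ≤ k ≤ d` of the paper
is coordinate `k - 1` here). -/
noncomputable def bField (d : ℕ) (h p : ℝ) (u : Fin d → ℝ) (i : Fin d) : ℝ :=
  if (i : ℕ) = 0 then (2 / h ^ 2) * (-coordFn u 0 + coordFn u 1)
  else if (i : ℕ) = d - 1 then
    (2 / h ^ 2) * (-coordFn u (d - 1) + coordFn u (d - 2)
      + h * ((max (coordFn u (d - 1)) 0) ^ p - coordFn u (d - 1)))
  else (1 / h ^ 2) * (coordFn u ((i : ℕ) + 1) - 2 * coordFn u (i : ℕ) + coordFn u ((i : ℕ) - 1))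

/-- A weak maximum principle: if every coordinate attaining the maximum of `V s` is either bounded
by `M` or non-increasing, then an initial bound by `M` persists. -/
theorem le_of_deriv_nonpos_at_max {ι : Type*} [Finite ι] {V V' : ℝ → ι → ℝ} {t M : ℝ}
    (ht : 0 ≤ t) (hV : ∀ s ∈ Icc 0 t, HasDerivWithinAt V (V' s) (Icc 0 t) s)
    (h0 : ∀ i, V 0 i ≤ M)
    (hmax : ∀ s ∈ Icc 0 t, ∀ i, (∀ j, V s j ≤ V s i) → V s i ≤ M ∨ V' s i ≤ 0) (k : ι) :
    V t k ≤ M := by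
  have hd : ∀ i, ∀ s ∈ Icc 0 t, HasDerivWithinAt (fun x => V x i) (V' s i) (Icc 0 t) s :=
    fun i s hs => hasDerivWithinAt_pi.1 (hV s hs) i
  have key : ∀ ε > 0, V t k - ε * t ≤ M := by
    intro ε hε
    have hW : ∀ i, ∀ s ∈ Icc 0 t,
        HasDerivWithinAt (fun x => V x i - ε * x) (V' s i - ε) (Icc 0 t) s := by
      intro i s hs
      have := (hd i s hs).fun_sub ((hasDerivWithinAt_id s (Icc 0 t)).const_mul ε)
      rwa [mul_one] at this
    have hex : ∀ i, ∃ s ∈ Icc 0 t, IsMaxOn (fun x => V x i - ε * x) (Icc 0 t) s := fun i =>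
      isCompact_Icc.exists_isMaxOn (nonempty_Icc.2 ht)
        fun s hs => (hW i s hs).continuousWithinAt
    choose σ hσ hσmax using hex
    have : Nonempty ι := ⟨k⟩
    obtain ⟨i, hi⟩ := Finite.exists_max fun i => V (σ i) i - ε * σ i
    have hglob : ∀ j, ∀ s ∈ Icc 0 t, V s j - ε * s ≤ V (σ i) i - ε * σ i :=
      fun j s hs => (hσmax j hs).trans (hi j)
    refine (hglob k t (right_mem_Icc.2 ht)).trans ?_
    rcases (hσ i).1.eq_or_lt with hz | hpos
    · rw [← hz]
      simpa using h0 i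
    · rcases hmax (σ i) (hσ i) i fun j => by linarith [hglob j (σ i) (hσ i)] with hM | hneg
      · nlinarith
      · have hcone : (0 : ℝ) - σ i ∈ posTangentConeAt (Icc 0 t) (σ i) :=
          sub_mem_posTangentConeAt_of_segment_subset
            ((convex_Icc 0 t).segment_subset (hσ i) (left_mem_Icc.2 ht))
        have hle := (hσmax i).localize.hasFDerivWithinAt_nonpos
          (hW i (σ i) (hσ i)).hasFDerivWithinAt hcone
        simp at hle
        nlinarith
  refine le_of_forall_pos_le_add fun δ hδ => ?_
  have h1 := key (δ / (t + 1)) (by positivity)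
  have h2 : δ / (t + 1) * t ≤ δ := by
    rw [div_mul_eq_mul_div, div_le_iff₀ (by positivity)]
    nlinarith
  linarith

/-- At a non-boundary coordinate dominating all others, `σ • bField` is non-positive. -/
theorem mul_bField_nonpos {d : ℕ} (hd : 2 ≤ d) {h : ℝ} (p : ℝ) {σ : ℝ} {u : Fin d → ℝ}
    {i : Fin d} (hi : (i : ℕ) ≠ d - 1) (hu : ∀ j, σ * u j ≤ σ * u i) :
    σ * bField d h p u i ≤ 0 := by
  have hc : ∀ n < d, σ * coordFn u n ≤ σ * u i := fun n hn => by
    simpa [coordFn, hn] using hu ⟨n, hn⟩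
  have hui : coordFn u (i : ℕ) = u i := by simp [coordFn]
  have hh : 0 ≤ 1 / h ^ 2 := by positivity
  have hlt := i.isLt
  by_cases h0 : (i : ℕ) = 0
  · have h1 := hc 1 (by omega)
    rw [h0] at hui
    rw [bField, if_pos h0, hui]
    have : 0 ≤ 1 / h ^ 2 * (σ * u i - σ * coordFn u 1) := mul_nonneg hh (by linarith)
    linear_combination 2 * this
  · have h1 := hc (i + 1) (by omega)
    have h2 := hc (i - 1) (by omega)
    rw [bField, if_neg h0, if_neg hi, hui]
    have : 0 ≤ 1 / h ^ 2 * (2 * (σ * u i) - σ * coordFn u (i + 1) - σ * coordFn u (i - 1)) :=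
      mul_nonneg hh (by linarith)
    linear_combination this

/-- for a solution `U` of (1.1) on `[0,T]`, every coordinate
satisfies `|U_k(t)| ≤ max{max_j |U_j(0)|, max_{0 ≤ s ≤ t} |U_d(s)|}`. -/
theorem stmt2 (d : ℕ) (hd : 2 ≤ d) (h p T : ℝ) (hh : 0 < h) (hp : 1 < p) (hT : 0 < T)
    (U : ℝ → Fin d → ℝ)
    (hU : ∀ t ∈ Set.Icc 0 T, HasDerivWithinAt U (bField d h p (U t)) (Set.Icc 0 T) t)
    (t : ℝ) (ht : t ∈ Set.Icc 0 T) (k : Fin d) :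
    |U t k| ≤ max (⨆ j : Fin d, |U 0 j|)
      (sSup ((fun s => |coordFn (U s) (d - 1)|) '' Set.Icc 0 t)) := by
  set M := max (⨆ j : Fin d, |U 0 j|)
    (sSup ((fun s => |coordFn (U s) (d - 1)|) '' Set.Icc 0 t)) with hM
  have hsub : Icc 0 t ⊆ Icc 0 T := Icc_subset_Icc_right ht.2
  have hUt : ∀ s ∈ Icc 0 t, HasDerivWithinAt U (bField d h p (U s)) (Icc 0 t) s :=
    fun s hs => (hU s (hsub hs)).mono hsub
  have hinit : ∀ j, |U 0 j| ≤ M := fun j =>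
    (le_ciSup (f := fun j => |U 0 j|) (Set.finite_range _).bddAbove j).trans (le_max_left _ _)
  have hlast : ∀ s ∈ Icc 0 t, ∀ i : Fin d, (i : ℕ) = d - 1 → |U s i| ≤ M := by
    intro s hs i hi
    have hcoord : ∀ s, coordFn (U s) (d - 1) = U s i := fun s => by
      rw [← hi]
      simp [coordFn]
    have hcont : ContinuousOn (fun s => |coordFn (U s) (d - 1)|) (Icc 0 t) := by
      simp only [hcoord]
      exact fun s hs => (hasDerivWithinAt_pi.1 (hUt s hs) i).continuousWithinAt.abs
    rw [← hcoord]
    exact (le_csSup (isCompact_Icc.image_of_continuousOn hcont).bddAbove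
      (mem_image_of_mem _ hs)).trans (le_max_right _ _)
  have hsign : ∀ σ : ℝ, |σ| = 1 → σ * U t k ≤ M := by
    intro σ hσ
    have habs : ∀ x, σ * x ≤ |x| := fun x => (le_abs_self _).trans (by rw [abs_mul, hσ, one_mul])
    refine le_of_deriv_nonpos_at_max (V := fun s i => σ * U s i)
      (V' := fun s i => σ * bField d h p (U s) i) ht.1
      (fun s hs => hasDerivWithinAt_pi.2 fun i =>
        (hasDerivWithinAt_pi.1 (hUt s hs) i).const_mul σ)
      (fun i => (habs _).trans (hinit i)) (fun s hs i hi => ?_) k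
    by_cases hid : (i : ℕ) = d - 1
    · exact Or.inl ((habs _).trans (hlast s hs i hid))
    · exact Or.inr (mul_bField_nonpos hd p hid hi)
  refine abs_le'.2 ⟨?_, ?_⟩
  · simpa using hsign 1 (by simp)
  · simpa using hsign (-1) (by simp)
end

section
/- (Trichotomy) For every u ∈ ℝ^d, exactly one of the following holds for the maximal solution U^u : [0, τ(u)) → ℝ^d of system (1.1) with U^u(0) = u: (i) τ(u) < ∞, i.e. U^u blows up in finite time; (ii) τ(u) = ∞ and U^u(t) → 0 as t → ∞; (iii) τ(u) = ∞ and U^u(t) → 𝟙 as t → ∞. -/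
open scoped BigOperators
open Filter Topology Set

/-- The Euclidean norm on `ℝ^d`. -/
noncomputable def euclNorm {d : ℕ} (u : Fin d → ℝ) : ℝ := Real.sqrt (∑ i, (u i) ^ 2)

/-- `u` belongs to the domain of explosion `D_e`: the (unique, maximal) solution of (1.1)
starting at `u` blows up in finite time, i.e. there are `τ < ∞` and a solution `U` of (1.1)
on `[0, τ)` with `U(0) = u` and `|U(t)| → ∞` as `t → τ⁻`. -/
def BlowsUp (d : ℕ) (h p : ℝ) (u : Fin d → ℝ) : Prop :=
  ∃ (τ : ℝ) (U : ℝ → Fin d → ℝ), 0 < τ ∧ U 0 = u ∧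
    (∀ t ∈ Set.Ico 0 τ, HasDerivWithinAt U (bField d h p (U t)) (Set.Ico 0 τ) t) ∧
    Filter.Tendsto (fun t => euclNorm (U t)) (nhdsWithin τ (Set.Iio τ)) Filter.atTop

/-- The (unique, maximal) solution of (1.1) starting at `u` is global and converges to `L`
as `t → ∞`. -/
def GlobalTo (d : ℕ) (h p : ℝ) (u L : Fin d → ℝ) : Prop :=
  ∃ U : ℝ → Fin d → ℝ, U 0 = u ∧
    (∀ t : ℝ, 0 ≤ t → HasDerivWithinAt U (bField d h p (U t)) (Set.Ici 0) t) ∧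
    Filter.Tendsto U Filter.atTop (nhds L)

/-- `U` solves `U' = f U` on `[0, T]` with `U 0 = u`. -/
def SolvesUpTo {E : Type*} [NormedAddCommGroup E] [NormedSpace ℝ E] (f : E → E) (u : E) (T : ℝ)
    (U : ℝ → E) : Prop :=
  U 0 = u ∧ ∀ t ∈ Icc 0 T, HasDerivWithinAt U (f (U t)) (Icc 0 T) t

section ODE

variable {E : Type*} [NormedAddCommGroup E] [NormedSpace ℝ E] {f : E → E} {u : E} {T : ℝ}
  {U V : ℝ → E}

theorem SolvesUpTo.mono {S : ℝ} (hU : SolvesUpTo f u T U) (hST : S ≤ T) : SolvesUpTo f u S U :=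
  ⟨hU.1, fun t ht => (hU.2 t ⟨ht.1, ht.2.trans hST⟩).mono (Icc_subset_Icc_right hST)⟩

theorem SolvesUpTo.continuousOn (hU : SolvesUpTo f u T U) : ContinuousOn U (Icc 0 T) :=
  fun t ht => (hU.2 t ht).continuousWithinAt

theorem solvesUpTo_zero (hU : U 0 = u) : SolvesUpTo f u 0 U := by
  refine ⟨hU, fun t ht => ?_⟩
  rw [Icc_self]
  exact HasFDerivWithinAt.of_subsingleton subsingleton_singleton

theorem SolvesUpTo.eqOn [ProperSpace E] (hf : LocallyLipschitz f) (hU : SolvesUpTo f u T U)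
    (hV : SolvesUpTo f u T V) : EqOn U V (Icc 0 T) := by
  have hK : IsCompact (U '' Icc 0 T ∪ V '' Icc 0 T) :=
    (isCompact_Icc.image_of_continuousOn hU.continuousOn).union
      (isCompact_Icc.image_of_continuousOn hV.continuousOn)
  obtain ⟨K, hL⟩ := LocallyLipschitzOn.exists_lipschitzOnWith_of_compact hK hf.locallyLipschitzOn
  have key : ∀ {W : ℝ → E}, SolvesUpTo f u T W → ∀ t ∈ Ico 0 T,
      HasDerivWithinAt W (f (W t)) (Ici t) t := fun hW t ht =>
    (hW.2 t ⟨ht.1, ht.2.le⟩).mono_of_mem_nhdsWithin (mem_of_superset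
      (Icc_mem_nhdsGE ht.2) (Icc_subset_Icc_left ht.1))
  exact ODE_solution_unique_of_mem_Icc_right (v := fun _ => f) (fun t _ => hL) hU.continuousOn
    (key hU) (fun t ht => Or.inl (mem_image_of_mem U ⟨ht.1, ht.2.le⟩)) hV.continuousOn
    (key hV) (fun t ht => Or.inr (mem_image_of_mem V ⟨ht.1, ht.2.le⟩)) (hU.1.trans hV.1.symm)

/-- Local solutions exist on a time interval that is uniform for bounded initial data. -/
theorem exists_uniform_local_solution [ProperSpace E] (hf : LocallyLipschitz f) (R : ℝ) :
    ∃ ε > 0, ∀ x, ‖x‖ ≤ R → ∀ t₀ : ℝ, ∃ α : ℝ → E, α t₀ = x ∧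
      ∀ t ∈ Icc (t₀ - ε) (t₀ + ε), HasDerivWithinAt α (f (α t)) (Icc (t₀ - ε) (t₀ + ε)) t := by
  have hB : IsCompact (Metric.closedBall (0 : E) (R + 1)) := isCompact_closedBall _ _
  obtain ⟨K, hK⟩ := LocallyLipschitzOn.exists_lipschitzOnWith_of_compact hB hf.locallyLipschitzOn
  obtain ⟨L, hL⟩ := hB.exists_bound_of_continuousOn hf.continuous.continuousOn
  set L' : NNReal := ⟨max L 0, le_max_right _ _⟩
  have hL0 : (0 : ℝ) ≤ L' := L'.2
  refine ⟨1 / (L' + 1), by positivity, fun x hx t₀ => ?_⟩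
  have hsub : Metric.closedBall x ((1 : NNReal) : ℝ) ⊆ Metric.closedBall 0 (R + 1) :=
    Metric.closedBall_subset_closedBall' (by rw [dist_zero_right]; simp; linarith)
  have hε : (0 : ℝ) < 1 / (L' + 1) := by positivity
  have hpl : IsPicardLindelof (fun _ => f) (tmin := t₀ - 1 / (L' + 1)) (tmax := t₀ + 1 / (L' + 1))
      ⟨t₀, by constructor <;> linarith⟩ x 1 0 L' K :=
    { lipschitzOnWith := fun t _ => hK.mono hsub
      continuousOn := fun x _ => continuousOn_const
      norm_le := fun t _ y hy => (hL y (hsub hy)).trans (le_max_left _ _)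
      mul_max_le := by
        simp only [add_sub_cancel_left, sub_sub_cancel, max_self, NNReal.coe_one, NNReal.coe_zero,
          sub_zero]
        rw [mul_one_div, div_le_one (by positivity)]
        linarith }
  exact hpl.exists_eq_forall_mem_Icc_hasDerivWithinAt₀

theorem hasDerivWithinAt_union_Icc {a b c t : ℝ} {v : E}
    (h₁ : t ≤ b → HasDerivWithinAt U v (Icc a b) t)
    (h₂ : b ≤ t → HasDerivWithinAt U v (Icc b c) t) (hab : a ≤ b) (hbc : b ≤ c) :
    HasDerivWithinAt U v (Icc a c) t := by
  rw [← Icc_union_Icc_eq_Icc hab hbc]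
  refine HasDerivWithinAt.union ?_ ?_
  · by_cases h : t ≤ b
    · exact h₁ h
    · exact HasFDerivWithinAt.of_notMem_closure (by rw [isClosed_Icc.closure_eq]; exact fun h' => h h'.2)
  · by_cases h : b ≤ t
    · exact h₂ h
    · exact HasFDerivWithinAt.of_notMem_closure (by rw [isClosed_Icc.closure_eq]; exact fun h' => h h'.1)

/-- A solution can be prolonged by a time that depends only on the size of its final value. -/
theorem exists_solution_extension [ProperSpace E] (hf : LocallyLipschitz f) (R : ℝ) :
    ∃ ε > 0, ∀ (u : E) (T : ℝ) (U : ℝ → E), 0 ≤ T → SolvesUpTo f u T U → ‖U T‖ ≤ R →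
      ∃ W, SolvesUpTo f u (T + ε) W := by
  obtain ⟨ε, hε, h⟩ := exists_uniform_local_solution hf R
  refine ⟨ε, hε, fun u T U hT hU hR => ?_⟩
  obtain ⟨α, hα0, hα⟩ := h (U T) hR T
  set W : ℝ → E := fun t => if t ≤ T then U t else α t with hW
  have hWU : ∀ t ≤ T, W t = U t := fun t ht => if_pos ht
  have hWα : ∀ t, T ≤ t → W t = α t := fun t ht => by
    rcases ht.eq_or_lt with rfl | h
    · rw [hWU _ le_rfl, hα0]
    · exact if_neg h.not_ge
  refine ⟨W, (hWU 0 hT).trans hU.1, fun t ht => ?_⟩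
  refine hasDerivWithinAt_union_Icc (fun h => ?_) (fun h => ?_) hT (by linarith)
  · rw [hWU t h]
    exact (hU.2 t ⟨ht.1, h⟩).congr (fun s hs => hWU s hs.2) (hWU t h)
  · rw [hWα t h]
    exact ((hα t ⟨by linarith, ht.2⟩).mono (Icc_subset_Icc_left (by linarith))).congr
      (fun s hs => hWα s hs.1) (hWα t h)

/-- The solution of an autonomous locally Lipschitz equation is either global, or leaves every
bounded set as time approaches some finite limit. -/
theorem exists_global_or_blowup [ProperSpace E] (hf : LocallyLipschitz f) (u : E) :
    (∃ U : ℝ → E, U 0 = u ∧ ∀ t, 0 ≤ t → HasDerivWithinAt U (f (U t)) (Ici 0) t) ∨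
    ∃ τ > 0, ∃ U : ℝ → E, U 0 = u ∧
      (∀ t ∈ Ico 0 τ, HasDerivWithinAt U (f (U t)) (Ico 0 τ) t) ∧
      Tendsto (fun t => ‖U t‖) (𝓝[<] τ) atTop := by
  have hsel : ∀ T : ℝ, ∃ U : ℝ → E, (∃ V, SolvesUpTo f u T V) → SolvesUpTo f u T U := fun T => by
    by_cases h : ∃ V, SolvesUpTo f u T V
    · exact ⟨h.choose, fun _ => h.choose_spec⟩
    · exact ⟨0, fun h' => absurd h' h⟩
  choose V hV using hsel
  set U : ℝ → E := fun t => V t t with hUdef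
  set S : Set ℝ := {T | ∃ V, SolvesUpTo f u T V} with hS
  have hdown : ∀ {T T'}, T ∈ S → T' ≤ T → T' ∈ S := fun ⟨W, hW⟩ h => ⟨W, hW.mono h⟩
  have h0 : (0 : ℝ) ∈ S := ⟨fun _ => u, solvesUpTo_zero rfl⟩
  have hU0 : U 0 = u := (hV 0 h0).1
  have hsol : ∀ T ∈ S, SolvesUpTo f u T U := fun T hT => by
    have heq : EqOn U (V T) (Icc 0 T) := fun t ht =>
      (hV t (hdown hT ht.2)).eqOn hf ((hV T hT).mono ht.2) ⟨ht.1, le_rfl⟩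
    refine ⟨hU0, fun t ht => ?_⟩
    rw [heq ht]
    exact ((hV T hT).2 t ht).congr heq (heq ht)
  by_cases hall : ∀ T, T ∈ S
  · refine Or.inl ⟨U, hU0, fun t ht => ?_⟩
    refine ((hsol (t + 1) (hall _)).2 t ⟨ht, by linarith⟩).mono_of_mem_nhdsWithin ?_
    rw [← Ici_inter_Iic]
    exact inter_mem self_mem_nhdsWithin (mem_nhdsWithin_of_mem_nhds (Iic_mem_nhds (by linarith)))
  · push Not at hall
    obtain ⟨T₁, hT₁⟩ := hall
    have hbdd : BddAbove S := ⟨T₁, fun T hT => by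
      by_contra h
      exact hT₁ (hdown hT (not_le.1 h).le)⟩
    have hlt : ∀ t < sSup S, t ∈ S := fun t ht => by
      obtain ⟨T, hT, htT⟩ := exists_lt_of_lt_csSup ⟨0, h0⟩ ht
      exact hdown hT htT.le
    have hext : ∀ R, ∃ ε > 0, ∀ t ∈ S, 0 ≤ t → ‖U t‖ ≤ R → t + ε ≤ sSup S := fun R => by
      obtain ⟨ε, hε, h⟩ := exists_solution_extension hf R
      exact ⟨ε, hε, fun t ht h0 hR => le_csSup hbdd (h u t U h0 (hsol t ht) hR)⟩
    have hpos : 0 < sSup S := by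
      obtain ⟨ε, hε, h⟩ := hext ‖U 0‖
      linarith [h 0 h0 le_rfl le_rfl]
    refine Or.inr ⟨sSup S, hpos, U, hU0, fun t ht => ?_, ?_⟩
    · obtain ⟨T, htT, hT⟩ := exists_between ht.2
      refine ((hsol T (hlt T hT)).2 t ⟨ht.1, htT.le⟩).mono_of_mem_nhdsWithin ?_
      exact mem_of_superset (inter_mem self_mem_nhdsWithin
        (mem_nhdsWithin_of_mem_nhds (Iic_mem_nhds htT))) fun s hs => ⟨hs.1.1, hs.2⟩
    · refine tendsto_atTop.2 fun R => ?_
      obtain ⟨ε, hε, h⟩ := hext R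
      have : ∀ᶠ t in 𝓝[<] (sSup S), max 0 (sSup S - ε) < t ∧ t < sSup S :=
        Ioo_mem_nhdsLT (max_lt hpos (by linarith))
      filter_upwards [this] with t ht
      by_contra hc
      have := h t (hlt t ht.2) ((le_max_left _ _).trans ht.1.le) (not_le.1 hc).le
      linarith [(le_max_right 0 (sSup S - ε)).trans_lt ht.1]

end ODE

section Lyapunov

variable {E : Type*} [NormedAddCommGroup E] [ProperSpace E]

/-- The dissipation of a Lyapunov function tends to zero along a bounded global trajectory. -/
theorem tendsto_dissipation_zero [NormedSpace ℝ E] {f : E → E} (hf : Continuous f) {U : ℝ → E} {M : ℝ}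
    (hU : ∀ t, 0 ≤ t → HasDerivWithinAt U (f (U t)) (Ici 0) t) (hM : ∀ t, 0 ≤ t → ‖U t‖ ≤ M)
    {Φ V : E → ℝ} (hΦ : Continuous Φ) (hV : Continuous V) (hV0 : ∀ x, 0 ≤ V x)
    (hΦU : ∀ t, 0 ≤ t → HasDerivWithinAt (fun t => Φ (U t)) (-V (U t)) (Ici 0) t) :
    Tendsto (fun t => V (U t)) atTop (𝓝 0) := by
  have hK : IsCompact (Metric.closedBall (0 : E) M) := isCompact_closedBall _ _
  have hUK : ∀ t, 0 ≤ t → U t ∈ Metric.closedBall (0 : E) M := fun t ht => by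
    simpa using hM t ht
  obtain ⟨L, hL⟩ := hK.exists_bound_of_continuousOn hf.continuousOn
  have hLip : ∀ s t, 0 ≤ s → 0 ≤ t → ‖U t - U s‖ ≤ L * ‖t - s‖ := fun s t hs ht =>
    (convex_Ici (0 : ℝ)).norm_image_sub_le_of_norm_hasDerivWithin_le hU
      (fun x hx => hL _ (hUK x hx)) hs ht
  have hanti : ∀ {s t c : ℝ}, 0 ≤ s → s ≤ t → (∀ r ∈ Icc s t, c ≤ V (U r)) →
      Φ (U t) - Φ (U s) ≤ -c * (t - s) := fun {s t c} hs hst hc => by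
    refine (convex_Icc s t).image_sub_le_mul_sub_of_deriv_le
      (f := fun t => Φ (U t)) (fun r hr => ?_) (fun r hr => ?_) (fun r hr => ?_)
      s (left_mem_Icc.2 hst) t (right_mem_Icc.2 hst) hst
    · exact ((hΦU r (hs.trans hr.1)).mono fun x hx => hs.trans hx.1).continuousWithinAt
    all_goals
      rw [interior_Icc] at hr
      have hd := (hΦU r (hs.trans hr.1.le)).hasDerivAt (Ici_mem_nhds (hs.trans_lt hr.1))
    · exact hd.differentiableAt.differentiableWithinAt
    · rw [hd.deriv]
      exact neg_le_neg (hc r ⟨hr.1.le, hr.2.le⟩)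
  have hmono : AntitoneOn (fun t => Φ (U t)) (Ici 0) := fun s hs t _ hst => by
    have := hanti hs hst (c := 0) fun r _ => hV0 _
    simpa using this
  obtain ⟨B, hB⟩ := hK.exists_bound_of_continuousOn hΦ.continuousOn
  have hlim : ∃ l, Tendsto (fun t => Φ (U (max t 0))) atTop (𝓝 l) := by
    refine ⟨_, tendsto_atTop_ciInf (fun s t hst => hmono (le_max_right s 0) (le_max_right t 0)
      (max_le_max_right 0 hst)) ⟨-B, ?_⟩⟩
    rintro _ ⟨t, rfl⟩
    exact (abs_le.1 (hB _ (hUK _ (le_max_right t 0)))).1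
  obtain ⟨l, hl⟩ := hlim
  have hVK := hK.uniformContinuousOn_of_continuous hV.continuousOn
  rw [Metric.uniformContinuousOn_iff] at hVK
  rw [Metric.tendsto_nhds]
  intro ε hε
  obtain ⟨δ, hδ, hVδ⟩ := hVK (ε / 2) (half_pos hε)
  set η : ℝ := δ / (2 * (|L| + 1)) with hη
  have hη0 : 0 < η := by positivity
  have hclose : Tendsto (fun t => Φ (U (max t 0)) - Φ (U (max (t + η) 0))) atTop (𝓝 0) := by
    simpa using hl.sub (hl.comp (tendsto_atTop_add_const_right atTop η tendsto_id))
  have hsmall := hclose.eventually (gt_mem_nhds (show 0 < ε / 2 * η by positivity))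
  filter_upwards [hsmall, eventually_ge_atTop 0] with t ht ht0
  rw [Real.dist_eq, sub_zero, abs_of_nonneg (hV0 _)]
  by_contra! hc
  rw [max_eq_left ht0, max_eq_left (by linarith)] at ht
  have := hanti ht0 (by linarith : t ≤ t + η) (c := ε / 2) fun r hr => by
    have hdist : dist (U r) (U t) < δ := by
      rw [dist_eq_norm]
      calc ‖U r - U t‖ ≤ L * ‖r - t‖ := hLip t r ht0 (ht0.trans hr.1)
        _ ≤ |L| * η := by
          rw [Real.norm_eq_abs, abs_of_nonneg (by linarith [hr.1])]
          exact mul_le_mul (le_abs_self L) (by linarith [hr.2]) (by linarith [hr.1]) (abs_nonneg L)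
        _ < (2 * (|L| + 1)) * η := by nlinarith [abs_nonneg L]
        _ = δ := by rw [hη]; field_simp
    have := hVδ _ (hUK r (ht0.trans hr.1)) _ (hUK t ht0) hdist
    rw [Real.dist_eq] at this
    linarith [(abs_lt.1 this).1]
  linarith

/-- A bounded continuous curve along which a continuous function vanishing only at two points tends
to zero converges to one of these points. -/
theorem tendsto_or_tendsto_of_tendsto_zero {U : ℝ → E} {M : ℝ} (hU : ContinuousOn U (Ici 0))
    (hM : ∀ t, 0 ≤ t → ‖U t‖ ≤ M) {V : E → ℝ} (hV : Continuous V) (hV0 : ∀ x, 0 ≤ V x) {a b : E}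
    (hab : a ≠ b) (hVab : ∀ x, V x = 0 → x = a ∨ x = b)
    (hVU : Tendsto (fun t => V (U t)) atTop (𝓝 0)) :
    Tendsto U atTop (𝓝 a) ∨ Tendsto U atTop (𝓝 b) := by
  have hnear : ∀ ε > 0, ∀ᶠ t in atTop, U t ∈ Metric.ball a ε ∪ Metric.ball b ε := fun ε hε => by
    have hK : IsCompact (Metric.closedBall (0 : E) M \ (Metric.ball a ε ∪ Metric.ball b ε)) :=
      (isCompact_closedBall _ _).diff (Metric.isOpen_ball.union Metric.isOpen_ball)
    obtain hKe | hKn := (Metric.closedBall (0 : E) M \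
      (Metric.ball a ε ∪ Metric.ball b ε)).eq_empty_or_nonempty
    · filter_upwards [eventually_ge_atTop 0] with t ht
      exact sdiff_eq_empty.1 hKe (by simpa using hM t ht)
    · obtain ⟨x, hx, hmin⟩ := hK.exists_isMinOn hKn hV.continuousOn
      have hpos : 0 < V x := (hV0 x).lt_of_ne' fun h0 => hx.2 <| by
        rcases hVab x h0 with rfl | rfl
        · exact Or.inl (Metric.mem_ball_self hε)
        · exact Or.inr (Metric.mem_ball_self hε)
      filter_upwards [eventually_ge_atTop 0, hVU.eventually (gt_mem_nhds hpos)] with t ht hlt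
      by_contra hc
      exact hlt.not_ge (hmin ⟨by simpa using hM t ht, hc⟩)
  have hdisj : Disjoint (Metric.ball a (dist a b / 2)) (Metric.ball b (dist a b / 2)) :=
    Metric.ball_disjoint_ball (by linarith)
  have hr : 0 < dist a b / 2 := half_pos (dist_pos.2 hab)
  have hconv : ∀ x y : E, Disjoint (Metric.ball x (dist a b / 2)) (Metric.ball y (dist a b / 2)) →
      (∀ ε > 0, ∀ᶠ t in atTop, U t ∈ Metric.ball x ε ∪ Metric.ball y ε) →
      (∀ᶠ t in atTop, U t ∈ Metric.ball x (dist a b / 2)) → Tendsto U atTop (𝓝 x) := by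
    intro x y hxy hball hx
    rw [Metric.tendsto_nhds]
    intro ε hε
    filter_upwards [hball _ (lt_min hε hr), hx] with t ht hxt
    rcases ht with ht | ht
    · exact Metric.ball_subset_ball (min_le_left _ _) ht
    · exact absurd (Metric.ball_subset_ball (min_le_right _ _) ht) (disjoint_left.1 hxy hxt)
  obtain ⟨T, hT⟩ := eventually_atTop.1 ((hnear _ hr).and (eventually_ge_atTop 0))
  have hconn : IsPreconnected (U '' Ici T) :=
    isPreconnected_Ici.image _ (hU.mono (Ici_subset_Ici.2 (hT T le_rfl).2))
  rcases hconn.subset_or_subset Metric.isOpen_ball Metric.isOpen_ball hdisj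
    (by rintro _ ⟨t, ht, rfl⟩; exact (hT t ht).1) with h | h
  · exact Or.inl (hconv a b hdisj hnear (eventually_atTop.2 ⟨T, fun t ht => h ⟨t, ht, rfl⟩⟩))
  · refine Or.inr (hconv b a hdisj.symm (fun ε hε => ?_)
      (eventually_atTop.2 ⟨T, fun t ht => h ⟨t, ht, rfl⟩⟩))
    simpa only [union_comm] using hnear ε hε

end Lyapunov

section PositivePart

theorem hasDerivAt_max_zero_rpow {q : ℝ} (hq : 1 < q) (x : ℝ) :
    HasDerivAt (fun x : ℝ => (max x 0) ^ q) (q * (max x 0) ^ (q - 1)) x := by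
  refine hasDerivAt_of_hasDerivAt_of_ne' (x := 0) (f := fun x : ℝ => (max x 0) ^ q)
    (g := fun x : ℝ => q * (max x 0) ^ (q - 1)) (fun y hy => ?_) ?_ ?_ x
  · rcases hy.lt_or_gt with h | h
    · have h0 : (fun x : ℝ => (max x 0) ^ q) =ᶠ[𝓝 y] fun _ => 0 := by
        filter_upwards [gt_mem_nhds h] with z hz
        rw [max_eq_right (le_of_lt hz), Real.zero_rpow (by linarith)]
      rw [max_eq_right h.le, Real.zero_rpow (by linarith), mul_zero]
      exact (hasDerivAt_const y (0 : ℝ)).congr_of_eventuallyEq h0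
    · have h0 : (fun x : ℝ => (max x 0) ^ q) =ᶠ[𝓝 y] fun x => x ^ q := by
        filter_upwards [lt_mem_nhds h] with z hz
        rw [max_eq_left (le_of_lt hz)]
      rw [max_eq_left h.le]
      exact (Real.hasDerivAt_rpow_const (Or.inl h.ne')).congr_of_eventuallyEq h0
  · exact ((continuous_id.max continuous_const).rpow_const
      fun _ => Or.inr (by linarith)).continuousAt
  · exact (((continuous_id.max continuous_const).rpow_const
      fun _ => Or.inr (by linarith)).const_mul q).continuousAt

theorem hasDerivAt_max_zero_sq (x : ℝ) :
    HasDerivAt (fun x : ℝ => (max x 0) ^ 2) (2 * max x 0) x := by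
  have := hasDerivAt_max_zero_rpow one_lt_two x
  norm_num at this
  exact this

theorem continuous_max_zero_rpow {q : ℝ} (hq : 0 ≤ q) : Continuous fun x : ℝ => (max x 0) ^ q :=
  (continuous_id.max continuous_const).rpow_const fun _ => Or.inr hq

theorem contDiff_max_zero_rpow {q : ℝ} (hq : 1 < q) : ContDiff ℝ 1 fun x : ℝ => (max x 0) ^ q := by
  rw [contDiff_one_iff_deriv]
  refine ⟨fun x => (hasDerivAt_max_zero_rpow hq x).differentiableAt, ?_⟩
  rw [funext fun x => (hasDerivAt_max_zero_rpow hq x).deriv]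
  exact (continuous_max_zero_rpow (by linarith)).const_mul q

/-- A function satisfying `y' ≥ c y ^ p` with `p > 1` above a positive level that it exceeds cannot
exist for all times. -/
theorem false_of_superlinear_growth {y y' : ℝ → ℝ} {p c R t₀ : ℝ} (hp : 1 < p) (hc : 0 < c)
    (hR : 0 < R) (hy : ∀ t, t₀ ≤ t → HasDerivWithinAt y (y' t) (Ici t₀) t)
    (hgrow : ∀ t, t₀ ≤ t → R ≤ y t → c * y t ^ p ≤ y' t) (h₀ : R ≤ y t₀) : False := by
  have hRpow : ∀ {x}, R ≤ x → 0 < x ^ p := fun hx => Real.rpow_pos_of_pos (hR.trans_le hx) p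
  have hge : ∀ t, t₀ ≤ t → R ≤ y t := fun t ht => by
    have := image_le_of_deriv_right_lt_deriv_boundary' (f := fun t => -y t) (f' := fun t => -y' t)
      (a := t₀) (b := t) (B := fun _ => -R) (B' := fun _ => 0)
      (fun s hs => ((hy s hs.1).neg.mono Icc_subset_Ici_self).continuousWithinAt)
      (fun s hs => (hy s hs.1).neg.mono (Ici_subset_Ici.2 hs.1)) (neg_le_neg h₀)
      continuousOn_const (fun s _ => hasDerivWithinAt_const s _ (-R)) (fun s hs hs' => by
        have hsR : R ≤ y s := (neg_injective hs').ge
        have := hgrow s hs.1 hsR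
        have := mul_pos hc (hRpow hsR)
        simp only [Left.neg_neg_iff]
        linarith) (right_mem_Icc.2 ht)
    exact neg_le_neg_iff.1 this
  have hpos : ∀ t, t₀ ≤ t → 0 < y t := fun t ht => hR.trans_le (hge t ht)
  have hz : ∀ t, t₀ ≤ t → HasDerivWithinAt (fun t => y t ^ (1 - p))
      (y' t * (1 - p) * y t ^ (1 - p - 1)) (Ici t₀) t := fun t ht =>
    (hy t ht).rpow_const (Or.inl (hpos t ht).ne')
  have hanti : AntitoneOn (fun t => y t ^ (1 - p) + (p - 1) * c * t) (Ici t₀) := by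
    refine antitoneOn_of_hasDerivWithinAt_nonpos (convex_Ici t₀)
      (f' := fun t => y' t * (1 - p) * y t ^ (1 - p - 1) + (p - 1) * c * 1)
      (fun t ht => (((hz t ht).add ((hasDerivWithinAt_id t _).const_mul _))).continuousWithinAt)
      (fun t ht => ((hz t (interior_subset ht)).add
        ((hasDerivWithinAt_id t _).const_mul _)).mono interior_subset) (fun t ht => ?_)
    have ht' : t₀ ≤ t := interior_subset ht
    have h1 := hgrow t ht' (hge t ht')
    have h2 : y t ^ p * y t ^ (1 - p - 1) = 1 := by
      rw [← Real.rpow_add (hpos t ht')]; simp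
    have h3 : 0 < y t ^ (1 - p - 1) := Real.rpow_pos_of_pos (hpos t ht') _
    have h4 : c ≤ y' t * y t ^ (1 - p - 1) := by
      calc c = c * y t ^ p * y t ^ (1 - p - 1) := by rw [mul_assoc, h2, mul_one]
        _ ≤ _ := mul_le_mul_of_nonneg_right h1 h3.le
    nlinarith [mul_le_mul_of_nonneg_left h4 (sub_pos.2 hp).le]
  have hk : 0 < (p - 1) * c := mul_pos (sub_pos.2 hp) hc
  set T := t₀ + y t₀ ^ (1 - p) / ((p - 1) * c) with hT
  have hz0 : 0 < y t₀ ^ (1 - p) := Real.rpow_pos_of_pos (hpos _ le_rfl) _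
  have hT0 : t₀ ≤ T := by rw [hT]; linarith [div_pos hz0 hk]
  have h := hanti (mem_Ici.2 le_rfl) (mem_Ici.2 hT0) hT0
  have hzT : 0 < y T ^ (1 - p) := Real.rpow_pos_of_pos (hpos _ hT0) _
  have heq : (p - 1) * c * T = (p - 1) * c * t₀ + y t₀ ^ (1 - p) := by
    rw [hT, mul_add, mul_div_cancel₀ _ hk.ne']
  simp only at h
  linarith

theorem exists_superlinear_bound {p c : ℝ} (hp : 1 < p) (hc : 0 < c) (a b : ℝ) :
    ∃ R > 0, ∀ x, R ≤ x → a * x + b ≤ c * x ^ p := by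
  have h : Tendsto (fun x : ℝ => c * x ^ (p - 1)) atTop atTop :=
    (tendsto_rpow_atTop (sub_pos.2 hp)).const_mul_atTop hc
  obtain ⟨R, hR⟩ := eventually_atTop.1 (h.eventually_ge_atTop (a + |b|))
  refine ⟨max R 1, lt_max_of_lt_right one_pos, fun x hx => ?_⟩
  have hx1 : 1 ≤ x := (le_max_right _ _).trans hx
  have hxp : x ^ p = x ^ (p - 1) * x := by
    rw [← Real.rpow_add_one (by linarith)]; simp
  have h1 := mul_le_mul_of_nonneg_right (hR x ((le_max_left _ _).trans hx)) (by linarith : 0 ≤ x)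
  rw [hxp]
  nlinarith [le_abs_self b, abs_nonneg b]

end PositivePart

section Coordinates

variable {d : ℕ}

theorem coordFn_coe (u : Fin d → ℝ) (i : Fin d) : coordFn u i = u i := by simp [coordFn]

theorem coordFn_contDiff (k : ℕ) : ContDiff ℝ 1 fun u : Fin d → ℝ => coordFn u k := by
  unfold coordFn
  split_ifs
  · exact contDiff_apply ℝ ℝ _
  · exact contDiff_const

@[fun_prop]
theorem coordFn_continuous (k : ℕ) : Continuous fun u : Fin d → ℝ => coordFn u k :=
  (coordFn_contDiff k).continuous

theorem HasDerivWithinAt.coordFn {U : ℝ → Fin d → ℝ} {U' : Fin d → ℝ} {s : Set ℝ} {t : ℝ}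
    (hU : HasDerivWithinAt U U' s t) (k : ℕ) :
    HasDerivWithinAt (fun t => coordFn (U t) k) (_root_.coordFn U' k) s t := by
  unfold _root_.coordFn
  split_ifs with hk
  · exact (hasDerivWithinAt_pi.1 hU) ⟨k, hk⟩
  · exact hasDerivWithinAt_const _ _ _

theorem abs_coordFn_le_norm (u : Fin d → ℝ) (k : ℕ) : |coordFn u k| ≤ ‖u‖ := by
  unfold coordFn
  split_ifs with hk
  · exact norm_le_pi_norm u ⟨k, hk⟩
  · simp

theorem bField_contDiff (h : ℝ) {p : ℝ} (hp : 1 < p) : ContDiff ℝ 1 (bField d h p) := by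
  rw [contDiff_pi]
  intro i
  have hc := fun k => coordFn_contDiff (d := d) k
  unfold bField
  split_ifs
  · exact contDiff_const.mul ((hc _).neg.add (hc _))
  · exact contDiff_const.mul (((hc _).neg.add (hc _)).add (contDiff_const.mul
      (((contDiff_max_zero_rpow hp).comp (hc _)).sub (hc _))))
  · exact contDiff_const.mul (((hc _).sub (contDiff_const.mul (hc _))).add (hc _))

theorem continuous_euclNorm : Continuous fun u : Fin d → ℝ => euclNorm u := by
  unfold euclNorm
  fun_prop

theorem norm_le_euclNorm (u : Fin d → ℝ) : ‖u‖ ≤ euclNorm u := by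
  refine (pi_norm_le_iff_of_nonneg (Real.sqrt_nonneg _)).2 fun i => ?_
  rw [Real.norm_eq_abs, ← Real.sqrt_sq_eq_abs]
  exact Real.sqrt_le_sqrt
    (Finset.single_le_sum (f := fun i => u i ^ 2) (fun i _ => sq_nonneg _) (Finset.mem_univ i))

end Coordinates

section System

variable {n : ℕ} {h p : ℝ}

/-- The trapezoidal sum of the values of `F` at the nodes `0, …, n + 1`. -/
noncomputable def trapSum (n : ℕ) (F : ℕ → ℝ) : ℝ :=
  F 0 / 2 + ∑ i ∈ Finset.range n, F (i + 1) + F (n + 1) / 2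

theorem trapSum_nonneg {F : ℕ → ℝ} (hF : ∀ k, 0 ≤ F k) : 0 ≤ trapSum n F := by
  have := Finset.sum_nonneg fun i (_ : i ∈ Finset.range n) => hF (i + 1)
  unfold trapSum
  linarith [hF 0, hF (n + 1)]

theorem eq_zero_of_trapSum_le_zero {F : ℕ → ℝ} (hF : ∀ k, 0 ≤ F k) (h0 : trapSum n F ≤ 0) {k : ℕ}
    (hk : k < n + 2) : F k = 0 := by
  have hs := Finset.sum_nonneg fun i (_ : i ∈ Finset.range n) => hF (i + 1)
  unfold trapSum at h0
  have h1 := hF 0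
  have h2 := hF (n + 1)
  rcases k with _ | k
  · linarith
  · rcases (Nat.lt_succ_iff_lt_or_eq.1 (Nat.lt_of_succ_lt_succ hk)) with hk | rfl
    · exact (Finset.sum_eq_zero_iff_of_nonneg fun i _ => hF (i + 1)).1 (by linarith) k
        (Finset.mem_range.2 hk)
    · linarith

theorem HasDerivWithinAt.trapSum {F : ℝ → ℕ → ℝ} {F' : ℕ → ℝ} {s : Set ℝ} {t : ℝ}
    (hF : ∀ k, HasDerivWithinAt (fun t => F t k) (F' k) s t) :
    HasDerivWithinAt (fun t => trapSum n (F t)) (trapSum n F') s t :=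
  (((hF 0).div_const 2).add (HasDerivWithinAt.fun_sum fun i _ => hF (i + 1))).add
    ((hF (n + 1)).div_const 2)

theorem trapSum_laplacian (v w : ℕ → ℝ) :
    v 0 * (w 1 - w 0) + ∑ i ∈ Finset.range n, v (i + 1) * (w (i + 2) - 2 * w (i + 1) + w i)
      + v (n + 1) * (w n - w (n + 1))
      = -∑ i ∈ Finset.range (n + 1), (v (i + 1) - v i) * (w (i + 1) - w i) := by
  induction n with
  | zero => simp; ring
  | succ n ih =>
    rw [Finset.sum_range_succ] at ih ⊢
    rw [Finset.sum_range_succ, Finset.sum_range_succ]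
    linarith

/-- The reaction term at the right boundary. -/
noncomputable def reaction (p x : ℝ) : ℝ := (max x 0) ^ p - x

theorem trapSum_mul_bField (hh : h ≠ 0) (u : Fin (n + 2) → ℝ) (v : ℕ → ℝ) :
    trapSum n (fun k => v k * coordFn (bField (n + 2) h p u) k) =
      -(1 / h ^ 2) * ∑ i ∈ Finset.range (n + 1),
        (v (i + 1) - v i) * (coordFn u (i + 1) - coordFn u i)
      + 1 / h * (v (n + 1) * reaction p (coordFn u (n + 1))) := by
  have h0 : coordFn (bField (n + 2) h p u) 0 = 2 / h ^ 2 * (-coordFn u 0 + coordFn u 1) := by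
    rw [coordFn, dif_pos (by omega), bField, if_pos rfl]
  have hm : ∀ i ∈ Finset.range n, v (i + 1) * coordFn (bField (n + 2) h p u) (i + 1) =
      1 / h ^ 2 * (v (i + 1) * (coordFn u (i + 2) - 2 * coordFn u (i + 1) + coordFn u i)) := by
    intro i hi
    rw [Finset.mem_range] at hi
    rw [coordFn, dif_pos (by omega), bField, if_neg (by simp), if_neg (by simp; omega)]
    simp only [Nat.add_sub_cancel]
    ring_nf
  have hl : coordFn (bField (n + 2) h p u) (n + 1) = 2 / h ^ 2 * (-coordFn u (n + 1) + coordFn u n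
      + h * reaction p (coordFn u (n + 1))) := by
    rw [coordFn, dif_pos (by omega), bField, if_neg (by simp), if_pos (by simp)]
    rfl
  have key := trapSum_laplacian (n := n) v (coordFn u)
  rw [trapSum, Finset.sum_congr rfl hm, h0, hl, ← Finset.mul_sum, neg_mul, ← mul_neg, ← key]
  field_simp
  ring

/-- A convex penalty with monotone derivative that vanishes initially stays zero along the flow if
it is not increased by the boundary reaction. -/
theorem penalty_eq_zero (hh : h ≠ 0) {U : ℝ → Fin (n + 2) → ℝ}
    (hU : ∀ t, 0 ≤ t → HasDerivWithinAt U (bField (n + 2) h p (U t)) (Ici 0) t)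
    {Θ θ : ℝ → ℝ} (hΘ : ∀ x, HasDerivAt Θ (θ x) x) (hθ : Monotone θ) (hΘ0 : ∀ x, 0 ≤ Θ x)
    (hbdry : ∀ t, 0 ≤ t →
      1 / h * (θ (coordFn (U t) (n + 1)) * reaction p (coordFn (U t) (n + 1))) ≤ 0)
    (hinit : ∀ k < n + 2, Θ (coordFn (U 0) k) = 0) {t : ℝ} (ht : 0 ≤ t) {k : ℕ} (hk : k < n + 2) :
    Θ (coordFn (U t) k) = 0 := by
  have hd : ∀ t, 0 ≤ t → HasDerivWithinAt (fun t => trapSum n fun k => Θ (coordFn (U t) k))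
      (trapSum n fun k => θ (coordFn (U t) k) * coordFn (bField (n + 2) h p (U t)) k) (Ici 0) t :=
    fun t ht => HasDerivWithinAt.trapSum fun k =>
      (hΘ _).comp_hasDerivWithinAt t ((hU t ht).coordFn k)
  have hanti : AntitoneOn (fun t => trapSum n fun k => Θ (coordFn (U t) k)) (Ici 0) := by
    refine antitoneOn_of_hasDerivWithinAt_nonpos (convex_Ici 0)
      (fun t ht => (hd t ht).continuousWithinAt)
      (fun t ht => (hd t (interior_subset ht)).mono interior_subset) (fun t ht => ?_)
    rw [trapSum_mul_bField hh (U t) fun k => θ (coordFn (U t) k)]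
    have hs : 0 ≤ ∑ i ∈ Finset.range (n + 1),
        (θ (coordFn (U t) (i + 1)) - θ (coordFn (U t) i)) *
          (coordFn (U t) (i + 1) - coordFn (U t) i) :=
      Finset.sum_nonneg fun i _ => by
        rcases le_total (coordFn (U t) i) (coordFn (U t) (i + 1)) with hle | hle
        · exact mul_nonneg (sub_nonneg.2 (hθ hle)) (sub_nonneg.2 hle)
        · exact mul_nonneg_of_nonpos_of_nonpos (sub_nonpos.2 (hθ hle)) (sub_nonpos.2 hle)
    have := mul_nonneg (one_div_nonneg.2 (sq_nonneg h)) hs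
    have := hbdry t (interior_subset ht)
    linarith
  have h0 : trapSum n (fun k => Θ (coordFn (U 0) k)) = 0 := by
    rw [trapSum, hinit 0 (by omega), hinit (n + 1) (by omega),
      Finset.sum_eq_zero fun i hi => hinit (i + 1) (by rw [Finset.mem_range] at hi; omega)]
    simp
  exact eq_zero_of_trapSum_le_zero (F := fun k => Θ (coordFn (U t) k)) (fun k => hΘ0 _)
    ((hanti (mem_Ici.2 le_rfl) (mem_Ici.2 ht) ht).trans h0.le) hk

theorem neg_le_coordFn (hh : 0 < h) (hp : 1 < p) {U : ℝ → Fin (n + 2) → ℝ}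
    (hU : ∀ t, 0 ≤ t → HasDerivWithinAt U (bField (n + 2) h p (U t)) (Ici 0) t) {K : ℝ}
    (hK : 0 ≤ K) (hinit : ∀ k < n + 2, -K ≤ coordFn (U 0) k) {t : ℝ} (ht : 0 ≤ t) {k : ℕ}
    (hk : k < n + 2) : -K ≤ coordFn (U t) k := by
  have := penalty_eq_zero hh.ne' hU (Θ := fun x => (max (-K - x) 0) ^ 2)
    (θ := fun x => 2 * max (-K - x) 0 * (-1))
    (fun x => (hasDerivAt_max_zero_sq (-K - x)).comp x ((hasDerivAt_id x).const_sub (-K)))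
    (fun x y hxy => by
      have := max_le_max_right 0 (show -K - y ≤ -K - x by linarith)
      simp only
      linarith) (fun x => sq_nonneg _)
    (fun t _ => by
      refine mul_nonpos_of_nonneg_of_nonpos (one_div_nonneg.2 hh.le) ?_
      set x := coordFn (U t) (n + 1)
      rcases le_total (-K - x) 0 with hx | hx
      · simp [max_eq_right hx]
      · have hx0 : x ≤ 0 := by linarith
        rw [max_eq_left hx, reaction, max_eq_right hx0, Real.zero_rpow (by linarith)]
        nlinarith)
    (fun k hk => by simp [max_eq_right (show -K - coordFn (U 0) k ≤ 0 by linarith [hinit k hk])])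
    ht hk
  have h0 : max (-K - coordFn (U t) k) 0 = 0 := pow_eq_zero_iff two_ne_zero |>.1 this
  linarith [max_eq_right_iff.1 h0]

theorem coordFn_le (hh : h ≠ 0) {U : ℝ → Fin (n + 2) → ℝ}
    (hU : ∀ t, 0 ≤ t → HasDerivWithinAt U (bField (n + 2) h p (U t)) (Ici 0) t) {K : ℝ}
    (hbdry : ∀ t, 0 ≤ t → coordFn (U t) (n + 1) ≤ K)
    (hinit : ∀ k < n + 2, coordFn (U 0) k ≤ K) {t : ℝ} (ht : 0 ≤ t) {k : ℕ}
    (hk : k < n + 2) : coordFn (U t) k ≤ K := by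
  have := penalty_eq_zero hh hU (Θ := fun x => (max (x - K) 0) ^ 2)
    (θ := fun x => 2 * max (x - K) 0 * 1)
    (fun x => (hasDerivAt_max_zero_sq (x - K)).comp x ((hasDerivAt_id x).sub_const K))
    (fun x y hxy => by
      have := max_le_max_right 0 (show x - K ≤ y - K by linarith)
      simp only
      linarith) (fun x => sq_nonneg _)
    (fun t ht => by simp [max_eq_right (sub_nonpos.2 (hbdry t ht))])
    (fun k hk => by simp [max_eq_right (sub_nonpos.2 (hinit k hk))]) ht hk
  have h0 : max (coordFn (U t) k - K) 0 = 0 := pow_eq_zero_iff two_ne_zero |>.1 this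
  linarith [max_eq_right_iff.1 h0]

/-- Global solutions are bounded. -/
theorem exists_bound_of_global (hh : 0 < h) (hp : 1 < p) {U : ℝ → Fin (n + 2) → ℝ}
    (hU : ∀ t, 0 ≤ t → HasDerivWithinAt U (bField (n + 2) h p (U t)) (Ici 0) t) :
    ∃ M, ∀ t, 0 ≤ t → ‖U t‖ ≤ M := by
  set K := ‖U 0‖ with hK
  have hK0 : 0 ≤ K := norm_nonneg _
  have hlow : ∀ t, 0 ≤ t → ∀ k < n + 2, -K ≤ coordFn (U t) k := fun t ht k hk =>
    neg_le_coordFn hh hp hU hK0 (fun k _ => (abs_le.1 (abs_coordFn_le_norm (U 0) k)).1) ht hk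
  obtain ⟨R, hR, hsup⟩ := exists_superlinear_bound hp (one_div_pos.2 hh)
    (2 / h ^ 2 * (1 + h)) (2 / h ^ 2 * K)
  have hbdry : ∀ t, 0 ≤ t → coordFn (U t) (n + 1) ≤ R := fun t₀ ht₀ => by
    by_contra! hlt
    refine false_of_superlinear_growth hp (one_div_pos.2 hh) hR
      (fun t ht => ((hU t (ht₀.trans ht)).coordFn (n + 1)).mono (Ici_subset_Ici.2 ht₀))
      (fun t ht hRt => ?_) hlt.le
    have hb : coordFn (bField (n + 2) h p (U t)) (n + 1) = 2 / h ^ 2 *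
        (-coordFn (U t) (n + 1) + coordFn (U t) n + h * reaction p (coordFn (U t) (n + 1))) := by
      rw [coordFn, dif_pos (by omega), bField, if_neg (by simp), if_pos (by simp)]
      rfl
    have hn := hlow t (ht₀.trans ht) n (by omega)
    rw [hb, reaction, max_eq_left (hR.le.trans hRt)]
    have h1 := hsup _ hRt
    have h2 : 2 / h ^ 2 * (h * coordFn (U t) (n + 1) ^ p) =
        2 * (1 / h * coordFn (U t) (n + 1) ^ p) := by
      field_simp
    have h3 := mul_le_mul_of_nonneg_left hn (by positivity : 0 ≤ 2 / h ^ 2)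
    linarith
  refine ⟨max K R, fun t ht => (pi_norm_le_iff_of_nonneg (le_max_of_le_left hK0)).2 fun i => ?_⟩
  rw [Real.norm_eq_abs, abs_le, ← coordFn_coe (U t) i]
  constructor
  · linarith [hlow t ht i i.2, le_max_left K R]
  · exact coordFn_le hh.ne' hU (fun t ht => (hbdry t ht).trans (le_max_right _ _))
      (fun k _ => ((abs_le.1 (abs_coordFn_le_norm (U 0) k)).2).trans (le_max_left _ _)) ht i.2

/-- The energy, whose weighted gradient flow is the system. -/
noncomputable def energy (n : ℕ) (h p : ℝ) (u : Fin (n + 2) → ℝ) : ℝ :=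
  1 / h ^ 2 * (∑ i ∈ Finset.range (n + 1), (coordFn u (i + 1) - coordFn u i) ^ 2 / 2)
    - 1 / h * ((max (coordFn u (n + 1)) 0) ^ (p + 1) / (p + 1) - coordFn u (n + 1) ^ 2 / 2)

/-- The rate at which the energy is dissipated. -/
noncomputable def dissipation (n : ℕ) (h p : ℝ) (u : Fin (n + 2) → ℝ) : ℝ :=
  trapSum n fun k => coordFn (bField (n + 2) h p u) k ^ 2

theorem dissipation_nonneg (u : Fin (n + 2) → ℝ) : 0 ≤ dissipation n h p u :=
  trapSum_nonneg fun _ => sq_nonneg _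

theorem continuous_dissipation (hp : 1 < p) : Continuous (dissipation n h p) := by
  have hb : ∀ k, Continuous fun u => coordFn (bField (n + 2) h p u) k := fun k =>
    (coordFn_continuous k).comp (bField_contDiff h hp).continuous
  unfold dissipation trapSum
  fun_prop

theorem continuous_energy (hp : 1 < p) : Continuous (energy n h p) := by
  have hr : Continuous fun u : Fin (n + 2) → ℝ => (max (coordFn u (n + 1)) 0) ^ (p + 1) :=
    (continuous_max_zero_rpow (by linarith)).comp (coordFn_continuous (n + 1))
  unfold energy
  fun_prop

theorem hasDerivWithinAt_energy (hh : h ≠ 0) (hp : 1 < p) {U : ℝ → Fin (n + 2) → ℝ} {s : Set ℝ}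
    {t : ℝ} (hU : HasDerivWithinAt U (bField (n + 2) h p (U t)) s t) :
    HasDerivWithinAt (fun t => energy n h p (U t)) (-dissipation n h p (U t)) s t := by
  have hc := fun k => hU.coordFn k
  have hG := ((hasDerivAt_max_zero_rpow (show 1 < p + 1 by linarith)
    (coordFn (U t) (n + 1))).comp_hasDerivWithinAt t (hc (n + 1))).div_const (p + 1)
  have hS := (HasDerivWithinAt.fun_sum (u := Finset.range (n + 1)) fun i _ =>
    (((hc (i + 1)).sub (hc i)).pow 2).div_const 2).const_mul (1 / h ^ 2)
  have hE := hS.sub ((hG.sub (((hc (n + 1)).pow 2).div_const 2)).const_mul (1 / h))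
  refine hE.congr_deriv ?_
  have key := trapSum_mul_bField (p := p) hh (U t) fun k => coordFn (bField (n + 2) h p (U t)) k
  simp only [← sq] at key
  rw [dissipation, key, reaction]
  have hp1 : p + 1 ≠ 0 := by linarith
  rw [neg_add, neg_mul, neg_neg, sub_eq_add_neg]
  congr 1
  · congr 1
    refine Finset.sum_congr rfl fun i _ => ?_
    simp
    ring
  · simp only [add_sub_cancel_right, Nat.cast_ofNat, Nat.add_one_sub_one, pow_one]
    field_simp

theorem eq_const_of_dissipation_eq_zero (hh : 0 < h) (hp : 1 < p) {u : Fin (n + 2) → ℝ}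
    (hu : dissipation n h p u = 0) : u = 0 ∨ u = fun _ => 1 := by
  have hb : ∀ k, coordFn (bField (n + 2) h p u) k = 0 := fun k => by
    by_cases hk : k < n + 2
    · exact pow_eq_zero_iff two_ne_zero |>.1
        (eq_zero_of_trapSum_le_zero (fun k => sq_nonneg _) hu.le hk)
    · exact dif_neg hk
  have hid : ∀ v : ℕ → ℝ, 1 / h ^ 2 * ∑ i ∈ Finset.range (n + 1),
      (v (i + 1) - v i) * (coordFn u (i + 1) - coordFn u i) =
      1 / h * (v (n + 1) * reaction p (coordFn u (n + 1))) := fun v => by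
    have := trapSum_mul_bField (p := p) hh.ne' u v
    simp only [hb, mul_zero] at this
    simp only [trapSum, Finset.sum_const_zero, zero_div, add_zero] at this
    linarith
  have hreac : reaction p (coordFn u (n + 1)) = 0 := by
    have := hid fun _ => 1
    simpa [hh.ne'] using this
  have hsum : ∑ i ∈ Finset.range (n + 1), (coordFn u (i + 1) - coordFn u i) ^ 2 = 0 := by
    have := hid (coordFn u)
    simpa [hreac, hh.ne', ← sq] using this
  have hstep : ∀ k < n + 1, coordFn u (k + 1) = coordFn u k := fun k hk => by
    have := (Finset.sum_eq_zero_iff_of_nonneg fun i _ => sq_nonneg _).1 hsum k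
      (Finset.mem_range.2 hk)
    linarith [pow_eq_zero_iff two_ne_zero |>.1 this]
  have hconst : ∀ k < n + 2, coordFn u k = coordFn u 0 := by
    intro k
    induction k with
    | zero => exact fun _ => rfl
    | succ k ih => exact fun hk => (hstep k (by omega)).trans (ih (by omega))
  have hval : coordFn u 0 = 0 ∨ coordFn u 0 = 1 := by
    rw [hconst (n + 1) (by omega), reaction] at hreac
    set c := coordFn u 0
    rcases le_or_gt c 0 with hc | hc
    · rw [max_eq_right hc, Real.zero_rpow (by linarith)] at hreac
      exact Or.inl (by linarith)
    · rw [max_eq_left hc.le] at hreac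
      right
      have hc1 : c ^ (p - 1) = 1 := by
        rw [Real.rpow_sub_one hc.ne', sub_eq_zero.1 hreac, div_self hc.ne']
      exact (Real.rpow_left_inj hc.le zero_le_one (by linarith)).1 (hc1.trans (Real.one_rpow _).symm)
  refine hval.imp (fun hv => ?_) (fun hv => ?_)
  all_goals
    funext i
    rw [← coordFn_coe u i, hconst i i.2, hv]
    try rfl

theorem global_tendsto (hh : 0 < h) (hp : 1 < p) {U : ℝ → Fin (n + 2) → ℝ}
    (hU : ∀ t, 0 ≤ t → HasDerivWithinAt U (bField (n + 2) h p (U t)) (Ici 0) t) :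
    Tendsto U atTop (𝓝 0) ∨ Tendsto U atTop (𝓝 fun _ => 1) := by
  obtain ⟨M, hM⟩ := exists_bound_of_global hh hp hU
  refine tendsto_or_tendsto_of_tendsto_zero (fun t ht => (hU t ht).continuousWithinAt) hM
    (continuous_dissipation hp) dissipation_nonneg (fun h => zero_ne_one (congrFun h 0))
    (fun x hx => eq_const_of_dissipation_eq_zero hh hp hx) ?_
  exact tendsto_dissipation_zero (bField_contDiff h hp).continuous hU hM (continuous_energy hp)
    (continuous_dissipation hp) dissipation_nonneg
    fun t ht => hasDerivWithinAt_energy hh.ne' hp (hU t ht)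

end System

section Exclusivity

variable {d : ℕ} {h p : ℝ} {u L L' : Fin d → ℝ}

theorem solvesUpTo_of_global {U : ℝ → Fin d → ℝ} (hU0 : U 0 = u)
    (hU : ∀ t, 0 ≤ t → HasDerivWithinAt U (bField d h p (U t)) (Ici 0) t) (T : ℝ) :
    SolvesUpTo (bField d h p) u T U :=
  ⟨hU0, fun t ht => (hU t ht.1).mono Icc_subset_Ici_self⟩

theorem not_globalTo_of_blowsUp (hp : 1 < p) (hB : BlowsUp d h p u) : ¬ GlobalTo d h p u L := by
  rintro ⟨V, hV0, hV, -⟩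
  obtain ⟨τ, U, hτ, hU0, hU, hlim⟩ := hB
  have heq : ∀ t ∈ Ico 0 τ, U t = V t := fun t ht =>
    SolvesUpTo.eqOn (u := u) (T := t) (bField_contDiff h hp).locallyLipschitz
      ⟨hU0, fun s hs => (hU s ⟨hs.1, hs.2.trans_lt ht.2⟩).mono
        fun r hr => ⟨hr.1, hr.2.trans_lt ht.2⟩⟩ (solvesUpTo_of_global hV0 hV t) ⟨ht.1, le_rfl⟩
  have hIco : Ico 0 τ ∈ 𝓝[<] τ := mem_of_superset (Ioo_mem_nhdsLT hτ) Ioo_subset_Ico_self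
  have hVlim : Tendsto (fun t => euclNorm (V t)) (𝓝[<] τ) (𝓝 (euclNorm (V τ))) :=
    (continuous_euclNorm.tendsto _).comp (((hV τ hτ.le).continuousWithinAt).tendsto.mono_left
      (nhdsWithin_le_iff.2 (mem_of_superset hIco fun s hs => hs.1)))
  refine not_tendsto_nhds_of_tendsto_atTop (hlim.congr' ?_) _ hVlim
  filter_upwards [hIco] with t ht
  rw [heq t ht]

theorem GlobalTo.limit_unique (hp : 1 < p) (hL : GlobalTo d h p u L) (hL' : GlobalTo d h p u L') :
    L = L' := by
  obtain ⟨U, hU0, hU, hlim⟩ := hL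
  obtain ⟨V, hV0, hV, hlim'⟩ := hL'
  refine tendsto_nhds_unique (hlim.congr' ?_) hlim'
  filter_upwards [eventually_ge_atTop 0] with t ht
  exact (solvesUpTo_of_global hU0 hU t).eqOn (bField_contDiff h hp).locallyLipschitz
    (solvesUpTo_of_global hV0 hV t) ⟨ht, le_rfl⟩

end Exclusivity

/-- Trichotomy: for every initial datum `u`, exactly one of the following holds:
(i) the maximal solution blows up in finite time; (ii) it is global and tends to `0`;
(iii) it is global and tends to `𝟙 = (1,…,1)`. -/
theorem stmt4 (d : ℕ) (hd : 2 ≤ d) (h p : ℝ) (hh : 0 < h) (hp : 1 < p) (u : Fin d → ℝ) :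
    (BlowsUp d h p u ∧ ¬ GlobalTo d h p u 0 ∧ ¬ GlobalTo d h p u (fun _ => 1)) ∨
    (¬ BlowsUp d h p u ∧ GlobalTo d h p u 0 ∧ ¬ GlobalTo d h p u (fun _ => 1)) ∨
    (¬ BlowsUp d h p u ∧ ¬ GlobalTo d h p u 0 ∧ GlobalTo d h p u (fun _ => 1)) := by
  obtain ⟨n, rfl⟩ : ∃ n, d = n + 2 := ⟨d - 2, by omega⟩
  have h01 : (0 : Fin (n + 2) → ℝ) ≠ fun _ => 1 := fun h => zero_ne_one (congrFun h 0)
  rcases exists_global_or_blowup (bField_contDiff h hp).locallyLipschitz u with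
    ⟨U, hU0, hU⟩ | ⟨τ, hτ, U, hU0, hU, hlim⟩
  · rcases global_tendsto hh hp hU with hlim | hlim
    · have hG : GlobalTo (n + 2) h p u 0 := ⟨U, hU0, hU, hlim⟩
      exact Or.inr (Or.inl ⟨fun hB => not_globalTo_of_blowsUp hp hB hG, hG,
        fun hG' => h01 (hG.limit_unique hp hG')⟩)
    · have hG : GlobalTo (n + 2) h p u fun _ => 1 := ⟨U, hU0, hU, hlim⟩
      exact Or.inr (Or.inr ⟨fun hB => not_globalTo_of_blowsUp hp hB hG,
        fun hG' => h01 (hG'.limit_unique hp hG), hG⟩)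
  · have hB : BlowsUp (n + 2) h p u :=
      ⟨τ, U, hτ, hU0, hU, tendsto_atTop_mono (fun t => norm_le_euclNorm (U t)) hlim⟩
    exact Or.inl ⟨hB, not_globalTo_of_blowsUp hp hB, not_globalTo_of_blowsUp hp hB⟩
end

section
/- (Saddle structure at 𝟙) Let J₁ be the d×d real matrix defined by (J₁u)_1 = (2/h²)(−u_1 + u_2), (J₁u)_i = (1/h²)(u_{i+1} − 2u_i + u_{i−1}) for 2 ≤ i ≤ d−1, and (J₁u)_d = (2/h²)(−u_d + u_{d−1}) + (2(p−1)/h)u_d (this is the Jacobian matrix of b at 𝟙 = (1,…,1), since g'(1) = p − 1). Then J₁ is diagonalizable over ℝ, all its eigenvalues are nonzero real numbers, exactly one eigenvalue is positive, and the remaining d − 1 eigenvalues (counted with multiplicity) are negative. -/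
open scoped BigOperators
open Filter Topology Set

section SymmetricOperator

variable {V : Type*} [NormedAddCommGroup V] [InnerProductSpace ℝ V]
  {T : V →ₗ[ℝ] V} {φ : V →ₗ[ℝ] ℝ}

/-- Two orthogonal eigenvectors with nonnegative eigenvalues cannot coexist if the quadratic form
is negative definite on a hyperplane. -/
lemma eq_zero_or_eq_zero_of_eigenvalues_nonneg
    (hneg : ∀ u, φ u = 0 → u ≠ 0 → inner ℝ (T u) u < 0) {u v : V} {μ ν : ℝ}
    (hu : T u = μ • u) (hv : T v = ν • v) (hμ : 0 ≤ μ) (hν : 0 ≤ ν) (huv : inner ℝ u v = 0) :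
    u = 0 ∨ v = 0 := by
  by_contra! hne
  have hvu : inner ℝ v u = 0 := by rw [real_inner_comm, huv]
  have hx : φ v • u - φ u • v = 0 := by
    by_contra hx
    have hlt := hneg (φ v • u - φ u • v) (by simp [mul_comm]) hx
    simp only [map_sub, map_smul, hu, hv, inner_sub_left, inner_sub_right, real_inner_smul_left,
      real_inner_smul_right, huv, hvu, real_inner_self_eq_norm_sq] at hlt
    nlinarith [mul_nonneg hμ (sq_nonneg (φ v * ‖u‖)), mul_nonneg hν (sq_nonneg (φ u * ‖v‖))]
  have hφ : φ v = 0 := by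
    have := congrArg (fun x => inner ℝ x u) hx
    simpa [inner_sub_left, real_inner_smul_left, hvu, hne.1] using this
  have hlt := hneg v hφ hne.2
  rw [hv, real_inner_smul_left, real_inner_self_eq_norm_sq] at hlt
  nlinarith [mul_nonneg hν (sq_nonneg ‖v‖)]

/-- An eigenspace for a nonnegative eigenvalue is at most one-dimensional if the quadratic form
is negative definite on a hyperplane. -/
lemma finrank_eigenspace_le_one
    (hneg : ∀ u, φ u = 0 → u ≠ 0 → inner ℝ (T u) u < 0) {μ : ℝ} (hμ : 0 ≤ μ) :
    Module.finrank ℝ (Module.End.eigenspace T μ) ≤ 1 := by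
  have hinj : Function.Injective (φ ∘ₗ (Module.End.eigenspace T μ).subtype) := by
    rw [← LinearMap.ker_eq_bot, LinearMap.ker_eq_bot']
    rintro ⟨v, hv⟩ hφ
    rw [Module.End.mem_eigenspace_iff] at hv
    by_contra hne
    have hlt := hneg v hφ (by simpa using hne)
    rw [hv, real_inner_smul_left, real_inner_self_eq_norm_sq] at hlt
    nlinarith [mul_nonneg hμ (sq_nonneg ‖v‖)]
  simpa using LinearMap.finrank_le_finrank_of_injective hinj

variable [FiniteDimensional ℝ V]

lemma LinearMap.IsSymmetric.iSup_eigenspace_eq_top (hT : T.IsSymmetric) :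
    ⨆ μ : ℝ, Module.End.eigenspace T μ = ⊤ := by
  rw [← Submodule.orthogonal_eq_bot_iff]
  exact hT.orthogonalComplement_iSup_eigenspaces_eq_bot

lemma LinearMap.IsSymmetric.exists_hasEigenvalue_pos (hT : T.IsSymmetric) {e : V}
    (he : 0 < inner ℝ (T e) e) : ∃ μ : ℝ, Module.End.HasEigenvalue T μ ∧ 0 < μ := by
  by_contra! hle
  let b := hT.eigenvectorBasis rfl
  have hsum : inner ℝ (T e) e = ∑ i, hT.eigenvalues rfl i * (inner ℝ (b i) e) ^ 2 := by
    rw [← b.sum_inner_mul_inner]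
    refine Finset.sum_congr rfl fun i _ => ?_
    rw [hT, hT.apply_eigenvectorBasis, real_inner_comm]
    simp only [RCLike.ofReal_real_eq_id, id_eq, real_inner_smul_left, b]
    rw [real_inner_comm]
    ring
  have hnonpos : ∑ i, hT.eigenvalues rfl i * (inner ℝ (b i) e) ^ 2 ≤ 0 :=
    Finset.sum_nonpos fun i _ => mul_nonpos_of_nonpos_of_nonneg
      (hle _ (hT.hasEigenvalue_eigenvalues rfl i)) (sq_nonneg _)
  linarith

/-- A symmetric operator whose quadratic form is negative definite on a hyperplane and positive
somewhere has exactly one nonnegative eigenvalue, which is positive and simple. -/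
theorem LinearMap.IsSymmetric.saddle (hT : T.IsSymmetric)
    (hneg : ∀ u, φ u = 0 → u ≠ 0 → inner ℝ (T u) u < 0) {e : V} (he : 0 < inner ℝ (T e) e) :
    (⨆ μ : ℝ, Module.End.eigenspace T μ) = ⊤ ∧
    (∀ μ : ℝ, Module.End.HasEigenvalue T μ → μ ≠ 0) ∧
    (∃! μ : ℝ, Module.End.HasEigenvalue T μ ∧ 0 < μ) ∧
    (∀ μ : ℝ, Module.End.HasEigenvalue T μ → 0 < μ →
      Module.finrank ℝ (Module.End.eigenspace T μ) = 1) ∧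
    Module.finrank ℝ
      ↥(⨆ μ : {x : ℝ // x < 0}, Module.End.eigenspace T (μ : ℝ)) = Module.finrank ℝ V - 1 := by
  have huniq : ∀ μ ν : ℝ, Module.End.HasEigenvalue T μ → Module.End.HasEigenvalue T ν →
      0 ≤ μ → 0 ≤ ν → μ = ν := by
    intro μ ν hμ hν hμ0 hν0
    by_contra hne
    obtain ⟨u, hu⟩ := hμ.exists_hasEigenvector
    obtain ⟨v, hv⟩ := hν.exists_hasEigenvector
    have horth : inner ℝ u v = 0 :=
      hT.orthogonalFamily_eigenspaces hne ⟨u, hu.1⟩ ⟨v, hv.1⟩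
    rcases eq_zero_or_eq_zero_of_eigenvalues_nonneg hneg hu.apply_eq_smul hv.apply_eq_smul
      hμ0 hν0 horth with h | h
    exacts [hu.2 h, hv.2 h]
  have hsimple : ∀ μ : ℝ, Module.End.HasEigenvalue T μ → 0 < μ →
      Module.finrank ℝ (Module.End.eigenspace T μ) = 1 := fun μ hμ hμ0 =>
    le_antisymm (finrank_eigenspace_le_one hneg hμ0.le)
      (Submodule.one_le_finrank_iff.mpr hμ)
  obtain ⟨μ₀, hμ₀, hpos⟩ := hT.exists_hasEigenvalue_pos he
  refine ⟨hT.iSup_eigenspace_eq_top, ?_, ⟨μ₀, ⟨hμ₀, hpos⟩, fun ν hν =>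
    huniq _ _ hν.1 hμ₀ hν.2.le hpos.le⟩, hsimple, ?_⟩
  · rintro μ hμ rfl
    exact hpos.ne (huniq _ _ hμ hμ₀ le_rfl hpos.le)
  · set N := ⨆ μ : {x : ℝ // x < 0}, Module.End.eigenspace T (μ : ℝ)
    have hcodisj : N ⊔ Module.End.eigenspace T μ₀ = ⊤ := by
      rw [eq_top_iff, ← hT.iSup_eigenspace_eq_top]
      refine iSup_le fun μ => ?_
      rcases lt_or_ge μ 0 with hμ | hμ
      · exact le_sup_of_le_left
          (le_iSup (fun μ : {x : ℝ // x < 0} => Module.End.eigenspace T (μ : ℝ)) ⟨μ, hμ⟩)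
      · by_cases hE : Module.End.HasEigenvalue T μ
        · rw [huniq _ _ hE hμ₀ hμ hpos.le]
          exact le_sup_right
        · have hbot : Module.End.eigenspace T μ = ⊥ := by
            by_contra hne
            exact hE hne
          simp [hbot]
    have hdisj : Disjoint N (Module.End.eigenspace T μ₀) := by
      refine ((Module.End.eigenspaces_iSupIndep T) μ₀).symm.mono_left ?_
      exact iSup_le fun μ => le_iSup₂_of_le (μ : ℝ) (μ.2.trans hpos).ne le_rfl
    have hadd := Submodule.finrank_sup_add_finrank_inf_eq N (Module.End.eigenspace T μ₀)
    rw [hcodisj, hdisj.eq_bot, finrank_top, finrank_bot, hsimple μ₀ hμ₀ hpos] at hadd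
    omega

end SymmetricOperator

/-- The inner product on `ℝ^ι` with positive weights `w`. -/
@[reducible] def weightedCore {ι : Type*} [Fintype ι] (w : ι → ℝ) (hw : ∀ i, 0 < w i) :
    InnerProductSpace.Core ℝ (ι → ℝ) where
  inner u v := ∑ i, w i * (u i * v i)
  conj_inner_symm u v := by simp [mul_comm]
  re_inner_nonneg u := by
    exact Finset.sum_nonneg fun i _ => mul_nonneg (hw i).le (mul_self_nonneg _)
  add_left u v z := by simp [add_mul, mul_add, Finset.sum_add_distrib]
  smul_left u v r := by simp [Finset.mul_sum, mul_assoc, mul_left_comm]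
  definite u hu := by
    have h0 := (Finset.sum_eq_zero_iff_of_nonneg fun i _ =>
      mul_nonneg (hw i).le (mul_self_nonneg (u i))).mp hu
    ext i
    simpa [(hw i).ne'] using h0 i (Finset.mem_univ i)

/-- `LinearMap.IsSymmetric.saddle` for an inner product given by its core. -/
theorem saddle_of_core {V : Type*} [AddCommGroup V] [Module ℝ V] [FiniteDimensional ℝ V]
    (c : InnerProductSpace.Core ℝ V) {T : V →ₗ[ℝ] V} {φ : V →ₗ[ℝ] ℝ}
    (hT : ∀ u v, c.inner (T u) v = c.inner u (T v))
    (hneg : ∀ u, φ u = 0 → u ≠ 0 → c.inner (T u) u < 0) {e : V} (he : 0 < c.inner (T e) e) :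
    (⨆ μ : ℝ, Module.End.eigenspace T μ) = ⊤ ∧
    (∀ μ : ℝ, Module.End.HasEigenvalue T μ → μ ≠ 0) ∧
    (∃! μ : ℝ, Module.End.HasEigenvalue T μ ∧ 0 < μ) ∧
    (∀ μ : ℝ, Module.End.HasEigenvalue T μ → 0 < μ →
      Module.finrank ℝ (Module.End.eigenspace T μ) = 1) ∧
    Module.finrank ℝ
      ↥(⨆ μ : {x : ℝ // x < 0}, Module.End.eigenspace T (μ : ℝ)) = Module.finrank ℝ V - 1 :=
  letI := c.toNormedAddCommGroup
  letI := InnerProductSpace.ofCore c.toCore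
  LinearMap.IsSymmetric.saddle (T := T) (φ := φ) hT hneg he

/-- Summation by parts for the second difference with Neumann boundary terms. -/
lemma sum_second_difference_mul (U W : ℕ → ℝ) (n : ℕ) :
    (U 1 - U 0) * W 0 + ∑ i ∈ Finset.range n, (U (i + 2) - 2 * U (i + 1) + U i) * W (i + 1)
        + (U n - U (n + 1)) * W (n + 1)
      = -∑ i ∈ Finset.range (n + 1), (U (i + 1) - U i) * (W (i + 1) - W i) := by
  induction n with
  | zero => simp; ring
  | succ n ih =>
    rw [Finset.sum_range_succ, Finset.sum_range_succ _ (n + 1)]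
    linarith

lemma coordFn_val {d : ℕ} (u : Fin d → ℝ) (i : Fin d) : coordFn u i = u i := by
  simp [coordFn]

/-- The weights making the discrete Laplacian symmetric. -/
def boundaryWeight (d : ℕ) (i : Fin d) : ℝ :=
  if (i : ℕ) = 0 ∨ (i : ℕ) = d - 1 then 1 else 2

lemma boundaryWeight_pos (d : ℕ) (i : Fin d) : 0 < boundaryWeight d i := by
  unfold boundaryWeight; split_ifs <;> norm_num

/-- The bilinear form of the linearization in the weighted inner product. -/
lemma weighted_sum_mulVec (n : ℕ) (h p : ℝ)
    (J : Matrix (Fin (n + 2)) (Fin (n + 2)) ℝ)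
    (hJ : ∀ (u : Fin (n + 2) → ℝ) (i : Fin (n + 2)),
      J.mulVec u i =
        if (i : ℕ) = 0 then (2 / h ^ 2) * (-coordFn u 0 + coordFn u 1)
        else if (i : ℕ) = n + 2 - 1 then
          (2 / h ^ 2) * (-coordFn u (n + 2 - 1) + coordFn u (n + 2 - 2))
            + (2 * (p - 1) / h) * coordFn u (n + 2 - 1)
        else (1 / h ^ 2) * (coordFn u ((i : ℕ) + 1) - 2 * coordFn u (i : ℕ)
          + coordFn u ((i : ℕ) - 1))) (u v : Fin (n + 2) → ℝ) :
    ∑ i, boundaryWeight (n + 2) i * (J.mulVec u i * v i)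
      = -(2 / h ^ 2) * ∑ i ∈ Finset.range (n + 1),
          (coordFn u (i + 1) - coordFn u i) * (coordFn v (i + 1) - coordFn v i)
        + (2 * (p - 1) / h) * (coordFn u (n + 1) * coordFn v (n + 1)) := by
  rw [neg_mul, ← mul_neg, ← sum_second_difference_mul, Fin.sum_univ_succ, Fin.sum_univ_castSucc,
    Finset.sum_range]
  have hmid : ∀ i : Fin n, boundaryWeight (n + 2) i.castSucc.succ *
      (J.mulVec u i.castSucc.succ * v i.castSucc.succ) = (2 / h ^ 2) *
        ((coordFn u (i + 2) - 2 * coordFn u (i + 1) + coordFn u i) * coordFn v (i + 1)) := by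
    intro i
    have hi : (i : ℕ) ≠ n := i.2.ne
    rw [hJ, ← coordFn_val v]
    simp [boundaryWeight, hi]
    ring
  simp only [hmid, ← Finset.mul_sum]
  rw [hJ, hJ, ← coordFn_val v, ← coordFn_val v]
  simp [boundaryWeight]
  ring

/-- Saddle structure at `𝟙`: the Jacobian matrix `J₁` of `b` at `𝟙` is
diagonalizable over `ℝ`, has only nonzero real eigenvalues, exactly one of which is positive
and is simple, while the negative eigenspaces together have dimension `d - 1` (i.e. the
remaining `d - 1` eigenvalues, counted with multiplicity, are negative). -/
theorem stmt8 (d : ℕ) (hd : 2 ≤ d) (h p : ℝ) (hh : 0 < h) (hp : 1 < p)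
    (J : Matrix (Fin d) (Fin d) ℝ)
    (hJ : ∀ (u : Fin d → ℝ) (i : Fin d),
      J.mulVec u i =
        if (i : ℕ) = 0 then (2 / h ^ 2) * (-coordFn u 0 + coordFn u 1)
        else if (i : ℕ) = d - 1 then
          (2 / h ^ 2) * (-coordFn u (d - 1) + coordFn u (d - 2))
            + (2 * (p - 1) / h) * coordFn u (d - 1)
        else (1 / h ^ 2) * (coordFn u ((i : ℕ) + 1) - 2 * coordFn u (i : ℕ)
          + coordFn u ((i : ℕ) - 1))) :
    (⨆ μ : ℝ, Module.End.eigenspace (Matrix.toLin' J) μ) = ⊤ ∧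
    (∀ μ : ℝ, Module.End.HasEigenvalue (Matrix.toLin' J) μ → μ ≠ 0) ∧
    (∃! μ : ℝ, Module.End.HasEigenvalue (Matrix.toLin' J) μ ∧ 0 < μ) ∧
    (∀ μ : ℝ, Module.End.HasEigenvalue (Matrix.toLin' J) μ → 0 < μ →
      Module.finrank ℝ (Module.End.eigenspace (Matrix.toLin' J) μ) = 1) ∧
    Module.finrank ℝ
      ↥(⨆ μ : {x : ℝ // x < 0}, Module.End.eigenspace (Matrix.toLin' J) (μ : ℝ)) = d - 1 := by
  obtain ⟨n, rfl⟩ := Nat.exists_eq_add_of_le' hd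
  have hform := weighted_sum_mulVec n h p J hJ
  have hc : 0 < 2 * (p - 1) / h := div_pos (by linarith) hh
  have hk : 0 < 2 / h ^ 2 := by positivity
  have key := saddle_of_core (weightedCore _ (boundaryWeight_pos (n + 2)))
    (T := Matrix.toLin' J) (φ := LinearMap.proj (Fin.last (n + 1))) (e := 1) ?_ ?_ ?_
  · simpa only [Module.finrank_fin_fun] using key
  · intro u v
    change ∑ i, boundaryWeight (n + 2) i * (J.mulVec u i * v i)
      = ∑ i, boundaryWeight (n + 2) i * (u i * J.mulVec v i)
    simp only [mul_comm (u _), hform, mul_comm (coordFn v _), mul_comm (coordFn v _ - _)]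
  · intro u hu hne
    change ∑ i, boundaryWeight (n + 2) i * (J.mulVec u i * u i) < 0
    have hlast : coordFn u (n + 1) = 0 := by
      rw [← hu]
      exact coordFn_val u (Fin.last (n + 1))
    rw [hform, hlast, mul_zero, mul_zero, add_zero, neg_mul, neg_lt_zero]
    refine mul_pos hk (lt_of_le_of_ne (Finset.sum_nonneg fun i _ => mul_self_nonneg _) ?_)
    intro h0
    rw [eq_comm, Finset.sum_eq_zero_iff_of_nonneg fun i _ => mul_self_nonneg _] at h0
    have hconst : ∀ k ≤ n + 1, coordFn u (n + 1 - k) = 0 := by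
      intro k
      induction k with
      | zero => simpa using hlast
      | succ k ih =>
        intro hk'
        have hstep := mul_self_eq_zero.mp (h0 (n + 1 - (k + 1)) (by simp))
        rw [show n + 1 - (k + 1) + 1 = n + 1 - k by omega, ih (by omega)] at hstep
        linarith
    refine hne (funext fun i => ?_)
    rw [← coordFn_val u i, show (i : ℕ) = n + 1 - (n + 1 - i) by omega]
    exact hconst _ (by omega)
  · change 0 < ∑ i, boundaryWeight (n + 2) i * (J.mulVec 1 i * (1 : Fin (n + 2) → ℝ) i)
    have hone : ∀ i < n + 2, coordFn (1 : Fin (n + 2) → ℝ) i = 1 := by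
      intro i hi
      simp [coordFn, hi]
    rw [hform, hone (n + 1) (by omega), Finset.sum_eq_zero]
    · simpa using hc
    · intro i hi
      have hi' := Finset.mem_range.mp hi
      rw [hone i (by omega), hone (i + 1) (by omega)]
      simp
end
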